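/- Let k ∈ ℕ, let X, a_0, …, a_k : ℝ → ℝ be smooth, and let b_0, …, b_k : ℝ → ℝ be smooth functions such that Σ_{i=0}^{k} b_i·φ^{(i)} = L_X^1( Σ_{i=0}^{k} a_i·φ^{(i)} ) − Σ_{i=0}^{k} a_i·(X·φ')^{(i)} for every smooth φ : ℝ → ℝ (i.e. the weights are λ = 0 and μ = 1, so that L_X^0 φ = X·φ'). Then Σ_{i=1}^{k} (−1)^{i−1}·b_i^{(i−1)} = X · ( Σ_{i=1}^{k} (−1)^{i−1}·a_i^{(i−1)} )'. (That is, the map A ↦ Σ_{i≥1} (−1)^{i−1} a_i^{(i−1)}, the coefficient of the operator P₁(A) = (Σ_{i≥1} (−1)^{i−1} a_i^{(i−1)}) ∘ d, transforms as a density of weight 0, so P₁ is an equivariant symmetry of the module D^k_{0,1}.) -/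

import Mathlib

open MeasureTheory

theorem ContDiff.smooth_deriv {f : ℝ → ℝ} (hf : ContDiff ℝ (⊤ : ℕ∞) f) :
    ContDiff ℝ (⊤ : ℕ∞) (deriv f) :=
  (contDiff_infty_iff_deriv.1 hf).2

theorem ContDiff.smooth_iteratedDeriv {f : ℝ → ℝ} (hf : ContDiff ℝ (⊤ : ℕ∞) f) (n : ℕ) :
    ContDiff ℝ (⊤ : ℕ∞) (iteratedDeriv n f) := by
  induction n with
  | zero => simpa using hf
  | succ n ih => rw [iteratedDeriv_succ]; exact ih.smooth_deriv

theorem ContDiff.smooth_hasDerivAt {f : ℝ → ℝ} (hf : ContDiff ℝ (⊤ : ℕ∞) f) (x : ℝ) :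
    HasDerivAt f (deriv f x) x :=
  ((contDiff_infty_iff_deriv.1 hf).1 x).hasDerivAt

theorem HasCompactSupport.hasCompactSupport_iteratedDeriv {f : ℝ → ℝ} (hf : HasCompactSupport f)
    (n : ℕ) : HasCompactSupport (iteratedDeriv n f) := by
  induction n with
  | zero => simpa using hf
  | succ n ih => rw [iteratedDeriv_succ]; exact ih.deriv

/-- Integration by parts against a smooth compactly supported function. -/
theorem integral_mul_deriv_of_hasCompactSupport {f g : ℝ → ℝ} (hf : ContDiff ℝ (⊤ : ℕ∞) f)
    (hg : ContDiff ℝ (⊤ : ℕ∞) g) (hgc : HasCompactSupport g) :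
    ∫ x, f x * deriv g x = -∫ x, deriv f x * g x :=
  integral_mul_deriv_eq_deriv_mul_of_integrable (fun x _ => hf.smooth_hasDerivAt x)
    (fun x _ => hg.smooth_hasDerivAt x)
    ((hf.continuous.mul hg.smooth_deriv.continuous).integrable_of_hasCompactSupport
      hgc.deriv.mul_left)
    ((hf.smooth_deriv.continuous.mul hg.continuous).integrable_of_hasCompactSupport hgc.mul_left)
    ((hf.continuous.mul hg.continuous).integrable_of_hasCompactSupport hgc.mul_left)

theorem integral_mul_iteratedDeriv_of_hasCompactSupport {f g : ℝ → ℝ}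
    (hf : ContDiff ℝ (⊤ : ℕ∞) f) (hg : ContDiff ℝ (⊤ : ℕ∞) g) (hgc : HasCompactSupport g) (n : ℕ) :
    ∫ x, f x * iteratedDeriv n g x = ∫ x, (-1) ^ n * iteratedDeriv n f x * g x := by
  induction n generalizing f with
  | zero => simp
  | succ n ih =>
    rw [iteratedDeriv_succ, integral_mul_deriv_of_hasCompactSupport hf
      (hg.smooth_iteratedDeriv n) (hgc.hasCompactSupport_iteratedDeriv n), ih hf.smooth_deriv,
      ← integral_neg, iteratedDeriv_succ']
    exact integral_congr_ae (.of_forall fun x => by simp only; ring)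

/-- The formal adjoint of `∑ i < k, a (i + 1) ∂ ^ i` applied to the constant function `1`. -/
noncomputable def adjointOne (k : ℕ) (a : ℕ → ℝ → ℝ) (x : ℝ) : ℝ :=
  ∑ i ∈ Finset.range k, (-1) ^ i * iteratedDeriv i (a (i + 1)) x

theorem sum_Icc_eq_adjointOne (k : ℕ) (a : ℕ → ℝ → ℝ) (x : ℝ) :
    ∑ i ∈ Finset.Icc 1 k, (-1 : ℝ) ^ (i - 1) * iteratedDeriv (i - 1) (a i) x
      = adjointOne k a x := by
  rw [← Finset.Ico_succ_right_eq_Icc, Finset.sum_Ico_eq_sum_range]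
  simp [adjointOne, add_comm 1]

theorem contDiff_adjointOne (k : ℕ) {a : ℕ → ℝ → ℝ} (ha : ∀ i, ContDiff ℝ (⊤ : ℕ∞) (a i)) :
    ContDiff ℝ (⊤ : ℕ∞) (adjointOne k a) :=
  ContDiff.sum fun i _ => contDiff_const.mul ((ha (i + 1)).smooth_iteratedDeriv i)

theorem contDiff_sum_mul_iteratedDeriv (k : ℕ) {a : ℕ → ℝ → ℝ}
    (ha : ∀ i, ContDiff ℝ (⊤ : ℕ∞) (a i)) {g : ℝ → ℝ} (hg : ContDiff ℝ (⊤ : ℕ∞) g) :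
    ContDiff ℝ (⊤ : ℕ∞) (fun x => ∑ i ∈ Finset.range k, a (i + 1) x * iteratedDeriv i g x) :=
  ContDiff.sum fun i _ => (ha (i + 1)).mul (hg.smooth_iteratedDeriv i)

theorem hasCompactSupport_sum_mul_iteratedDeriv (k : ℕ) (a : ℕ → ℝ → ℝ) {g : ℝ → ℝ}
    (hgc : HasCompactSupport g) :
    HasCompactSupport (fun x => ∑ i ∈ Finset.range k, a (i + 1) x * iteratedDeriv i g x) := by
  induction k with
  | zero => exact HasCompactSupport.zero
  | succ k ih =>
    simp only [Finset.sum_range_succ]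
    exact ih.add (hgc.hasCompactSupport_iteratedDeriv k).mul_left

theorem integral_sum_mul_iteratedDeriv (k : ℕ) {a : ℕ → ℝ → ℝ}
    (ha : ∀ i, ContDiff ℝ (⊤ : ℕ∞) (a i)) {g : ℝ → ℝ} (hg : ContDiff ℝ (⊤ : ℕ∞) g)
    (hgc : HasCompactSupport g) :
    ∫ x, ∑ i ∈ Finset.range k, a (i + 1) x * iteratedDeriv i g x
      = ∫ x, adjointOne k a x * g x := by
  simp only [adjointOne, Finset.sum_mul]
  rw [integral_finsetSum, integral_finsetSum]
  · exact Finset.sum_congr rfl fun i _ =>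
      integral_mul_iteratedDeriv_of_hasCompactSupport (ha _) hg hgc i
  · exact fun i _ => ((continuous_const.mul ((ha _).smooth_iteratedDeriv i).continuous).mul
      hg.continuous).integrable_of_hasCompactSupport hgc.mul_left
  · exact fun i _ => ((ha _).continuous.mul
      (hg.smooth_iteratedDeriv i).continuous).integrable_of_hasCompactSupport
        (hgc.hasCompactSupport_iteratedDeriv i).mul_left

theorem exists_smooth_antideriv {g : ℝ → ℝ} (hg : ContDiff ℝ (⊤ : ℕ∞) g) :
    ∃ φ : ℝ → ℝ, ContDiff ℝ (⊤ : ℕ∞) φ ∧ deriv φ = g := by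
  have h : deriv (fun x => ∫ t in (0 : ℝ)..x, g t) = g :=
    funext fun x => hg.continuous.deriv_integral _ 0 x
  refine ⟨_, contDiff_infty_iff_deriv.2 ⟨fun x => ?_, h.symm ▸ hg⟩, h⟩
  exact (hg.continuous.integral_hasStrictDerivAt 0 x).hasDerivAt.differentiableAt



/-- Lie derivative of a `lam`-density `φ` along the vector field `X`:
`L_X^lam φ = X·φ' + lam·X'·φ`. -/
noncomputable def lieDeriv (lam : ℝ) (X φ : ℝ → ℝ) : ℝ → ℝ :=
  fun x => X x * deriv φ x + lam * deriv X x * φ x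

/-- For weights `λ = 0`, `μ = 1`, the map `A ↦ Σ_{i≥1} (−1)^{i−1} a_i^{(i−1)}` (the
coefficient of the operator `P₁(A)`) transforms as a density of weight 0, so `P₁` is an
equivariant symmetry of the module `D^k_{0,1}`. -/
theorem P1_equivariant (k : ℕ) (X : ℝ → ℝ) (a b : ℕ → ℝ → ℝ)
    (hX : ContDiff ℝ (⊤ : ℕ∞) X)
    (ha : ∀ i, ContDiff ℝ (⊤ : ℕ∞) (a i)) (hbsmooth : ∀ i, ContDiff ℝ (⊤ : ℕ∞) (b i))
    (hb : ∀ φ : ℝ → ℝ, ContDiff ℝ (⊤ : ℕ∞) φ →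
      (fun x => ∑ i ∈ Finset.range (k+1), b i x * iteratedDeriv i φ x)
        = fun x =>
            lieDeriv 1 X (fun y => ∑ i ∈ Finset.range (k+1), a i y * iteratedDeriv i φ y) x
              - ∑ i ∈ Finset.range (k+1),
                  a i x * iteratedDeriv i (fun y => X y * deriv φ y) x) :
    (fun x => ∑ i ∈ Finset.Icc 1 k, (-1:ℝ)^(i-1) * iteratedDeriv (i-1) (b i) x)
      = fun x => X x *
          deriv (fun y => ∑ i ∈ Finset.Icc 1 k, (-1:ℝ)^(i-1) * iteratedDeriv (i-1) (a i) y) x := by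
  have key : ∀ g : ℝ → ℝ, ContDiff ℝ (⊤ : ℕ∞) g → ∀ x,
      ∑ i ∈ Finset.range k, b (i + 1) x * iteratedDeriv i g x
        = deriv (fun y => X y * ∑ i ∈ Finset.range k, a (i + 1) y * iteratedDeriv i g y) x
          - ∑ i ∈ Finset.range k,
              a (i + 1) x * iteratedDeriv i (deriv fun y => X y * g y) x := by
    intro g hg x
    obtain ⟨φ, hφ, rfl⟩ := exists_smooth_antideriv hg
    have h0 := congrFun (hb (fun _ => 1) contDiff_const) x
    have h1 := congrFun (hb φ hφ) x
    have hB := (contDiff_sum_mul_iteratedDeriv k ha hg).smooth_hasDerivAt x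
    have h2 := (hB.add (((ha 0).smooth_hasDerivAt x).mul (hφ.smooth_hasDerivAt x))).deriv
    have h3 := ((hX.smooth_hasDerivAt x).mul hB).deriv
    simp only [Pi.add_def, Pi.mul_def] at h2 h3
    simp only [lieDeriv, Finset.sum_range_succ', iteratedDeriv_succ', iteratedDeriv_zero,
      deriv_const', iteratedDeriv_fun_const_zero, mul_zero, mul_one, Finset.sum_const_zero,
      zero_add] at h0 h1
    rw [h2] at h1
    rw [h3]
    linear_combination h1 - φ x * h0
  have hp := contDiff_adjointOne k ha
  have hq := contDiff_adjointOne k hbsmooth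
  have weak : ∀ g : ℝ → ℝ, ContDiff ℝ (⊤ : ℕ∞) g → HasCompactSupport g →
      ∫ x, adjointOne k b x * g x = ∫ x, X x * deriv (adjointOne k a) x * g x := by
    intro g hg hgc
    have hBs := hX.mul (contDiff_sum_mul_iteratedDeriv k ha hg)
    have hBc : HasCompactSupport
        (fun y => X y * ∑ i ∈ Finset.range k, a (i + 1) y * iteratedDeriv i g y) :=
      (hasCompactSupport_sum_mul_iteratedDeriv k a hgc).mul_left
    have hXg := hX.mul hg
    have hXgc : HasCompactSupport (fun y => X y * g y) := hgc.mul_left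
    have hzero := integral_mul_deriv_of_hasCompactSupport (f := fun _ => 1) contDiff_const hBs hBc
    simp only [one_mul, deriv_const', zero_mul, integral_zero, neg_zero] at hzero
    rw [← integral_sum_mul_iteratedDeriv k hbsmooth hg hgc]
    simp only [key g hg]
    rw [integral_sub (hBs.smooth_deriv.continuous.integrable_of_hasCompactSupport hBc.deriv)
      ((contDiff_sum_mul_iteratedDeriv k ha
        hXg.smooth_deriv).continuous.integrable_of_hasCompactSupport
          (hasCompactSupport_sum_mul_iteratedDeriv k a hXgc.deriv)), hzero,
      integral_sum_mul_iteratedDeriv k ha hXg.smooth_deriv hXgc.deriv,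
      integral_mul_deriv_of_hasCompactSupport hp hXg hXgc, zero_sub, neg_neg]
    exact integral_congr_ae (.of_forall fun x => by simp only; ring)
  have hr : Continuous fun x => X x * deriv (adjointOne k a) x :=
    hX.continuous.mul hp.smooth_deriv.continuous
  simp only [sum_Icc_eq_adjointOne]
  refine (Continuous.ae_eq_iff_eq volume hq.continuous hr).1 ?_
  refine ae_eq_of_integral_contDiff_smul_eq hq.continuous.locallyIntegrable
    hr.locallyIntegrable fun g hg hgc => ?_
  simpa only [smul_eq_mul, mul_comm (g _)] using weak g hg hgc
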